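/- Let a, b ∈ ℝ³ with aᵢ < bᵢ for each i, let γ, α, β, ε > 0, let f : ℝ³ → ℝ be continuous on Icc a b, and let u₀ : ℝ³ → ℝ be twice continuously differentiable on a neighborhood of Icc a b with u₀ = 0 on the frontier of Icc a b, satisfying the Euler–Lagrange equation −γ·Δu₀ + α·u₀³ − β·u₀ − f = 0 on Icc a b. Define J(u₀) = (γ/2)∫‖∇u₀‖² dx + (α/4)∫u₀⁴ dx − (β/2)∫u₀² dx − ∫u₀·f dx and Ĵ_ε(u₀) = −(γ/2)∫‖∇u₀‖² dx − (3α/4)∫u₀⁴ dx + ((β+ε)/2)∫u₀² dx − (1/(2ε))∫(−γ·Δu₀ + α·u₀³ − (β+ε)·u₀ − f)² dx, all integrals over Icc a b. Then J(u₀) = Ĵ_ε(u₀). (Zero duality gap between the primal functional J and the primal–dual functional Ĵ_ε at a critical point of J, the central equality of the paper's main theorem, stated on a rectangular box so that the divergence theorem applies.) -/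

import Mathlib

open MeasureTheory

/-- The closed rectangular box `{x : aᵢ ≤ xᵢ ≤ bᵢ}` in `ℝ³`. -/
def closedBox (a b : Fin 3 → ℝ) : Set (EuclideanSpace ℝ (Fin 3)) :=
  {x | ∀ i, x i ∈ Set.Icc (a i) (b i)}

/-- The Laplacian of `u : ℝ³ → ℝ`, as the trace of the derivative of the
gradient of `u`. -/
noncomputable def lap (u : EuclideanSpace ℝ (Fin 3) → ℝ)
    (x : EuclideanSpace ℝ (Fin 3)) : ℝ :=
  LinearMap.trace ℝ (EuclideanSpace ℝ (Fin 3))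
    (fderiv ℝ (gradient u) x : EuclideanSpace ℝ (Fin 3) →ₗ[ℝ]
      EuclideanSpace ℝ (Fin 3))

theorem closedBox_eq_preimage_Icc (a b : Fin 3 → ℝ) :
    closedBox a b = EuclideanSpace.equiv (Fin 3) ℝ ⁻¹' Set.Icc a b := by
  ext x
  simp [closedBox, Pi.le_def, forall_and]

theorem isCompact_closedBox (a b : Fin 3 → ℝ) : IsCompact (closedBox a b) := by
  rw [closedBox_eq_preimage_Icc]
  exact (EuclideanSpace.equiv (Fin 3) ℝ).toHomeomorph.isCompact_preimage.2 isCompact_Icc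

theorem mem_frontier_closedBox {a b : Fin 3 → ℝ} {x : EuclideanSpace ℝ (Fin 3)}
    (hx : x ∈ closedBox a b) {i : Fin 3} (hi : x i = a i ∨ x i = b i) :
    x ∈ frontier (closedBox a b) := by
  rw [(isCompact_closedBox a b).isClosed.frontier_eq]
  refine ⟨hx, fun hint => ?_⟩
  have hpre : interior (closedBox a b) =
      EuclideanSpace.equiv (Fin 3) ℝ ⁻¹' interior (Set.Icc a b) := by
    rw [closedBox_eq_preimage_Icc]
    exact ((EuclideanSpace.equiv (Fin 3) ℝ).toHomeomorph.preimage_interior _).symm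
  rw [hpre, ← Set.pi_univ_Icc, interior_pi_set Set.finite_univ] at hint
  have h : x i ∈ interior (Set.Icc (a i) (b i)) := hint i (Set.mem_univ i)
  rw [interior_Icc] at h
  rcases hi with hi | hi
  · exact h.1.ne' hi
  · exact h.2.ne hi

/-- The trace of an endomorphism of `ℝ³` is the sum of its diagonal entries. -/
theorem trace_euclideanSpace_eq_sum
    (L : EuclideanSpace ℝ (Fin 3) →ₗ[ℝ] EuclideanSpace ℝ (Fin 3)) :
    LinearMap.trace ℝ _ L = ∑ i, L (EuclideanSpace.single i 1) i := by
  rw [L.trace_eq_sum_inner (EuclideanSpace.basisFun (Fin 3) ℝ)]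
  simp [EuclideanSpace.inner_single_left]

theorem continuous_trace_euclideanSpace :
    Continuous fun L : EuclideanSpace ℝ (Fin 3) →L[ℝ] EuclideanSpace ℝ (Fin 3) =>
      LinearMap.trace ℝ (EuclideanSpace ℝ (Fin 3))
        (L : EuclideanSpace ℝ (Fin 3) →ₗ[ℝ] EuclideanSpace ℝ (Fin 3)) := by
  simp only [trace_euclideanSpace_eq_sum, ContinuousLinearMap.coe_coe]
  fun_prop

/-- **Divergence theorem** on a box, for a vector field that vanishes on the boundary. -/
theorem integral_trace_fderiv_eq_zero {a b : Fin 3 → ℝ} (hab : a ≤ b)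
    {F : EuclideanSpace ℝ (Fin 3) → EuclideanSpace ℝ (Fin 3)}
    (hF : ∀ x ∈ closedBox a b, DifferentiableAt ℝ F x)
    (hF' : ContinuousOn (fderiv ℝ F) (closedBox a b))
    (hbd : ∀ x ∈ frontier (closedBox a b), F x = 0) :
    ∫ x in closedBox a b, LinearMap.trace ℝ (EuclideanSpace ℝ (Fin 3))
      (fderiv ℝ F x : EuclideanSpace ℝ (Fin 3) →ₗ[ℝ] EuclideanSpace ℝ (Fin 3)) = 0 := by
  set e := EuclideanSpace.equiv (Fin 3) ℝ with he
  have hmem : ∀ y, y ∈ Set.Icc a b → e.symm y ∈ closedBox a b := fun y hy => by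
    rwa [closedBox_eq_preimage_Icc, Set.mem_preimage, e.apply_symm_apply]
  have hvol : (∫ x in closedBox a b, LinearMap.trace ℝ (EuclideanSpace ℝ (Fin 3))
      (fderiv ℝ F x : EuclideanSpace ℝ (Fin 3) →ₗ[ℝ] EuclideanSpace ℝ (Fin 3))) =
      ∫ y in Set.Icc a b, LinearMap.trace ℝ (EuclideanSpace ℝ (Fin 3))
        (fderiv ℝ F (e.symm y) :
          EuclideanSpace ℝ (Fin 3) →ₗ[ℝ] EuclideanSpace ℝ (Fin 3)) := by
    rw [closedBox_eq_preimage_Icc, ← (PiLp.volume_preserving_ofLp (Fin 3)).setIntegral_preimage_emb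
      (MeasurableEquiv.toLp 2 (Fin 3 → ℝ)).symm.measurableEmbedding]
    rfl
  set G : Fin 3 → (Fin 3 → ℝ) → ℝ := fun i y => F (e.symm y) i with hG
  set G' : Fin 3 → (Fin 3 → ℝ) → (Fin 3 → ℝ) →L[ℝ] ℝ := fun i y =>
    (EuclideanSpace.proj i).comp ((fderiv ℝ F (e.symm y)).comp
      (e.symm : (Fin 3 → ℝ) →L[ℝ] EuclideanSpace ℝ (Fin 3))) with hG'
  have hderiv : ∀ y ∈ Set.Icc a b, ∀ i, HasFDerivAt (G i) (G' i y) y := fun y hy i =>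
    (EuclideanSpace.proj (𝕜 := ℝ) i).hasFDerivAt.comp y
      ((hF _ (hmem y hy)).hasFDerivAt.comp y e.symm.hasFDerivAt)
  have hdiv : ∀ y, LinearMap.trace ℝ (EuclideanSpace ℝ (Fin 3))
      (fderiv ℝ F (e.symm y) : EuclideanSpace ℝ (Fin 3) →ₗ[ℝ] EuclideanSpace ℝ (Fin 3)) =
      ∑ i, G' i y (Pi.single i 1) := fun y => by
    rw [trace_euclideanSpace_eq_sum]
    rfl
  have hcont : ContinuousOn (fun y => ∑ i, G' i y (Pi.single i 1)) (Set.Icc a b) := by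
    simp only [← hdiv]
    exact continuous_trace_euclideanSpace.comp_continuousOn
      (hF'.comp e.symm.continuous.continuousOn hmem)
  have hface : ∀ (i : Fin 3) (c : ℝ), c = a i ∨ c = b i →
      ∫ z in Set.Icc (a ∘ i.succAbove) (b ∘ i.succAbove), G i (i.insertNth c z) = 0 := by
    intro i c hc
    refine setIntegral_eq_zero_of_forall_eq_zero fun z hz => ?_
    have hy : i.insertNth c z ∈ Set.Icc a b := by
      refine Fin.insertNth_mem_Icc.2 ⟨?_, hz⟩
      rcases hc with rfl | rfl
      · exact Set.left_mem_Icc.2 (hab i)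
      · exact Set.right_mem_Icc.2 (hab i)
    have hfr := mem_frontier_closedBox (hmem _ hy) (i := i) (by simpa [he] using hc)
    simp [hG, hbd _ hfr]
  rw [hvol]
  simp only [hdiv]
  rw [integral_divergence_of_hasFDerivAt_off_countable' a b hab G G' ∅ Set.countable_empty
    (fun i y hy => (hderiv y hy i).continuousAt.continuousWithinAt)
    (fun y hy => hderiv y ⟨fun i => (hy.1 i trivial).1.le, fun i => (hy.1 i trivial).2.le⟩)
    (hcont.integrableOn_compact isCompact_Icc)]
  exact Finset.sum_eq_zero fun i _ => by
    rw [hface i _ (Or.inr rfl), hface i _ (Or.inl rfl), sub_zero]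

theorem ContDiffOn.gradient {u : EuclideanSpace ℝ (Fin 3) → ℝ}
    {U : Set (EuclideanSpace ℝ (Fin 3))} (hU : IsOpen U) (hu : ContDiffOn ℝ 2 u U) :
    ContDiffOn ℝ 1 (gradient u) U :=
  (InnerProductSpace.toDual ℝ (EuclideanSpace ℝ (Fin 3))).symm.contDiff.comp_contDiffOn
    (hu.fderiv_of_isOpen hU (by norm_num))

/-- Pointwise form of Green's first identity: `div (u ∇u) = u Δu + ‖∇u‖²`. -/
theorem trace_fderiv_smul_gradient {u : EuclideanSpace ℝ (Fin 3) → ℝ}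
    {x : EuclideanSpace ℝ (Fin 3)} (hu : DifferentiableAt ℝ u x)
    (hu' : DifferentiableAt ℝ (gradient u) x) :
    LinearMap.trace ℝ (EuclideanSpace ℝ (Fin 3))
      (fderiv ℝ (fun y => u y • gradient u y) x :
        EuclideanSpace ℝ (Fin 3) →ₗ[ℝ] EuclideanSpace ℝ (Fin 3)) =
      u x * lap u x + ‖gradient u x‖ ^ 2 := by
  have hsum : ‖gradient u x‖ ^ 2 = fderiv ℝ u x (gradient u x) := by
    rw [← real_inner_self_eq_norm_sq]
    exact InnerProductSpace.toDual_symm_apply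
  have hcoe : (((fderiv ℝ u x).smulRight (gradient u x) :
        EuclideanSpace ℝ (Fin 3) →L[ℝ] EuclideanSpace ℝ (Fin 3)) :
        EuclideanSpace ℝ (Fin 3) →ₗ[ℝ] EuclideanSpace ℝ (Fin 3)) =
      ((fderiv ℝ u x : EuclideanSpace ℝ (Fin 3) →ₗ[ℝ] ℝ)).smulRight (gradient u x) := rfl
  rw [fderiv_fun_smul hu hu', ContinuousLinearMap.toLinearMap_add,
    ContinuousLinearMap.toLinearMap_smul, map_add, map_smul, hcoe, LinearMap.trace_smulRight,
    hsum, lap, smul_eq_mul]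
  rfl

/-- Zero duality gap between the primal functional `J` and the primal–dual
functional `Ĵ_ε` at a critical point `u₀` of `J` (a solution of the
Euler–Lagrange equation `−γΔu₀ + αu₀³ − βu₀ − f = 0` with zero Dirichlet
boundary data on a rectangular box): `J(u₀) = Ĵ_ε(u₀)`. -/
theorem zero_duality_gap (a b : Fin 3 → ℝ) (hab : ∀ i, a i < b i)
    (γ α β ε : ℝ) (hγ : 0 < γ) (hα : 0 < α) (hβ : 0 < β) (hε : 0 < ε)
    (f u₀ : EuclideanSpace ℝ (Fin 3) → ℝ)
    (hf : ContinuousOn f (closedBox a b))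
    (U : Set (EuclideanSpace ℝ (Fin 3))) (hU : IsOpen U)
    (hBU : closedBox a b ⊆ U) (hu₀ : ContDiffOn ℝ 2 u₀ U)
    (hbd : ∀ x ∈ frontier (closedBox a b), u₀ x = 0)
    (hEL : ∀ x ∈ closedBox a b,
      -γ * lap u₀ x + α * u₀ x ^ 3 - β * u₀ x - f x = 0) :
    (γ / 2) * (∫ x in closedBox a b, ‖gradient u₀ x‖ ^ 2)
        + (α / 4) * (∫ x in closedBox a b, u₀ x ^ 4)
        - (β / 2) * (∫ x in closedBox a b, u₀ x ^ 2)
        - (∫ x in closedBox a b, u₀ x * f x) =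
      -(γ / 2) * (∫ x in closedBox a b, ‖gradient u₀ x‖ ^ 2)
        - (3 * α / 4) * (∫ x in closedBox a b, u₀ x ^ 4)
        + ((β + ε) / 2) * (∫ x in closedBox a b, u₀ x ^ 2)
        - (1 / (2 * ε)) * (∫ x in closedBox a b,
            (-γ * lap u₀ x + α * u₀ x ^ 3 - (β + ε) * u₀ x - f x) ^ 2) := by
  have hK := isCompact_closedBox a b
  have hgrad := hu₀.gradient hU
  have hu : ContinuousOn u₀ (closedBox a b) := hu₀.continuousOn.mono hBU
  have hg : ContinuousOn (gradient u₀) (closedBox a b) := hgrad.continuousOn.mono hBU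
  have hlap : ContinuousOn (lap u₀) (closedBox a b) :=
    continuous_trace_euclideanSpace.comp_continuousOn
      ((hgrad.continuousOn_fderiv_of_isOpen hU le_rfl).mono hBU)
  have hdu : ∀ x ∈ closedBox a b, DifferentiableAt ℝ u₀ x := fun x hx =>
    (hu₀.contDiffAt (hU.mem_nhds (hBU hx))).differentiableAt (by norm_num)
  have hdg : ∀ x ∈ closedBox a b, DifferentiableAt ℝ (gradient u₀) x := fun x hx =>
    (hgrad.contDiffAt (hU.mem_nhds (hBU hx))).differentiableAt (by norm_num)
  have hprod : ContDiffOn ℝ 1 (fun y => u₀ y • gradient u₀ y) U :=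
    (hu₀.of_le (by norm_num)).smul hgrad
  have hgreen := integral_trace_fderiv_eq_zero (fun i => (hab i).le)
    (fun x hx => (hdu x hx).fun_smul (hdg x hx))
    ((hprod.continuousOn_fderiv_of_isOpen hU le_rfl).mono hBU)
    (fun x hx => by rw [hbd x hx, zero_smul])
  have hintlap : IntegrableOn (fun x => u₀ x * lap u₀ x) (closedBox a b) :=
    (hu.mul hlap).integrableOn_compact hK
  have hintgrad : IntegrableOn (fun x => ‖gradient u₀ x‖ ^ 2) (closedBox a b) :=
    (hg.norm.pow 2).integrableOn_compact hK
  rw [setIntegral_congr_fun hK.measurableSet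
    (fun x hx => trace_fderiv_smul_gradient (hdu x hx) (hdg x hx)),
    integral_add hintlap hintgrad] at hgreen
  have huf : ∫ x in closedBox a b, u₀ x * f x =
      -γ * (∫ x in closedBox a b, u₀ x * lap u₀ x)
        + α * (∫ x in closedBox a b, u₀ x ^ 4)
        - β * (∫ x in closedBox a b, u₀ x ^ 2) := by
    rw [← integral_const_mul, ← integral_const_mul, ← integral_const_mul, ← integral_add,
      ← integral_sub]
    · exact setIntegral_congr_fun hK.measurableSet fun x hx => by
        linear_combination (-u₀ x) * hEL x hx
    · exact ((continuousOn_const.mul (hu.mul hlap)).add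
        (continuousOn_const.mul (hu.pow 4))).integrableOn_compact hK
    · exact (continuousOn_const.mul (hu.pow 2)).integrableOn_compact hK
    · exact (continuousOn_const.mul (hu.mul hlap)).integrableOn_compact hK
    · exact (continuousOn_const.mul (hu.pow 4)).integrableOn_compact hK
  have hres : ∫ x in closedBox a b,
      (-γ * lap u₀ x + α * u₀ x ^ 3 - (β + ε) * u₀ x - f x) ^ 2 =
      ε ^ 2 * ∫ x in closedBox a b, u₀ x ^ 2 := by
    rw [← integral_const_mul]
    refine setIntegral_congr_fun hK.measurableSet fun x hx => ?_
    have h : -γ * lap u₀ x + α * u₀ x ^ 3 - (β + ε) * u₀ x - f x = -(ε * u₀ x) := by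
      linear_combination hEL x hx
    simp only [h]
    ring
  rw [huf, hres]
  have hcoef : 1 / (2 * ε) * (ε ^ 2 * ∫ x in closedBox a b, u₀ x ^ 2) =
      ε / 2 * ∫ x in closedBox a b, u₀ x ^ 2 := by
    field_simp
  rw [hcoef]
  linear_combination γ * hgreen
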